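/- Let G be a finite tree with vertex set V, where |V| = n ≥ 2. Suppose P assigns a real number to every nonempty subset S ⊆ V whose induced subgraph is connected (hence a subtree of G), satisfying for every such S the recursion P(S) = 1 − (1/|S|²)·Σ_{v ∈ S} Σ_C |C|·P(C), where C ranges over the vertex sets of the connected components of the subgraph of G induced on S ∖ {v}. Then 13/30 < P(V) < 17/30. -/

import Mathlib

open Polynomial

namespace SimpleGraph

variable {V : Type*} {G : SimpleGraph V}

theorem Reachable.mem_of_closed {U : Set V} {C : Set V}
    (hC : ∀ a ∈ C, ∀ b ∈ U, G.Adj a b → b ∈ C) {a b : U} (h : (G.induce U).Reachable a b)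
    (ha : (a : V) ∈ C) : (b : V) ∈ C := by
  obtain ⟨w⟩ := h
  induction w with
  | nil => exact ha
  | cons hadj _ ih => exact ih (hC _ ha _ (Subtype.coe_prop _) hadj)

theorem Connected.subset_of_closed {U : Set V} (hU : (G.induce U).Connected) {C : Set V}
    (hC : ∀ a ∈ C, ∀ b ∈ U, G.Adj a b → b ∈ C) {x : V} (hxU : x ∈ U) (hxC : x ∈ C) : U ⊆ C :=
  fun z hz => (hU.preconnected ⟨x, hxU⟩ ⟨z, hz⟩).mem_of_closed hC hxC

theorem Connected.eq_singleton_of_forall_not_adj {S : Finset V}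
    (hS : (G.induce (S : Set V)).Connected) {x : V} (hx : x ∈ S) (h : ∀ y ∈ S, ¬G.Adj x y) :
    S = {x} := by
  have : (S : Set V) ⊆ {x} := by
    refine hS.subset_of_closed ?_ hx rfl
    rintro a rfl b hb hab
    exact absurd hab (h b hb)
  exact Finset.Subset.antisymm (fun z hz => by simpa using this hz) (by simpa using hx)

variable [Fintype V]

open Classical in
/-- The vertices that can be reached from `x` inside `U`; empty when `x ∉ U`. -/
noncomputable def componentIn (G : SimpleGraph V) (U : Set V) (x : V) : Finset V :=
  {z | ∃ (hx : x ∈ U) (hz : z ∈ U), (G.induce U).Reachable ⟨x, hx⟩ ⟨z, hz⟩}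

theorem mem_componentIn {U : Set V} {x z : V} : z ∈ G.componentIn U x ↔
    ∃ (hx : x ∈ U) (hz : z ∈ U), (G.induce U).Reachable ⟨x, hx⟩ ⟨z, hz⟩ := by
  simp [componentIn]

theorem self_mem_componentIn {U : Set V} {x : V} (hx : x ∈ U) : x ∈ G.componentIn U x :=
  mem_componentIn.2 ⟨hx, hx, .rfl⟩

theorem componentIn_subset {U : Set V} {x : V} : (G.componentIn U x : Set V) ⊆ U := fun _ hz =>
  let ⟨_, hz, _⟩ := mem_componentIn.1 hz
  hz

theorem componentIn_closed {U : Set V} {x : V} :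
    ∀ a ∈ G.componentIn U x, ∀ b ∈ U, G.Adj a b → b ∈ G.componentIn U x := by
  intro a ha b hb hab
  obtain ⟨hx, ha, h⟩ := mem_componentIn.1 ha
  exact mem_componentIn.2 ⟨hx, hb, h.trans (Adj.reachable hab)⟩

theorem connected_of_subset_componentIn {U : Set V} {x : V} (hx : x ∈ U)
    (h : U ⊆ G.componentIn U x) : (G.induce U).Connected := by
  rw [connected_iff_exists_forall_reachable]
  refine ⟨⟨x, hx⟩, fun z => ?_⟩
  obtain ⟨_, _, h⟩ := mem_componentIn.1 (h z.2)
  exact h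

theorem componentIn_eq {U : Set V} {C : Finset V} {x : V} (hx : x ∈ C) (hCU : (C : Set V) ⊆ U)
    (hC : (G.induce (C : Set V)).Connected)
    (hcl : ∀ a ∈ C, ∀ b ∈ U, G.Adj a b → b ∈ C) : G.componentIn U x = C := by
  apply Finset.Subset.antisymm
  · intro z hz
    obtain ⟨hxU, hz, h⟩ := mem_componentIn.1 hz
    exact h.mem_of_closed hcl hx
  · refine hC.subset_of_closed (fun a ha b hb => componentIn_closed a ha b (hCU hb)) hx ?_
    exact self_mem_componentIn (hCU hx)

theorem componentIn_connected {U : Set V} {x : V} (hx : x ∈ U) :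
    (G.induce (G.componentIn U x : Set V)).Connected := by
  refine connected_of_subset_componentIn (self_mem_componentIn hx) fun z hz => ?_
  obtain ⟨hx, hz, h⟩ := mem_componentIn.1 hz
  have key := h.mem_of_closed
    (C := G.componentIn (G.componentIn U x : Set V) x) ?_ ?_
  · exact key
  · intro a ha b hb hab
    exact componentIn_closed a ha b (componentIn_closed a (componentIn_subset ha) b hb hab) hab
  · exact self_mem_componentIn (self_mem_componentIn hx)

variable [DecidableEq V]

/-- The vertex set `S` falls into connected parts `A ∋ x` and `B ∋ y` joined by the edge `xy`
only. -/
structure IsEdgeSplit (G : SimpleGraph V) (A B : Finset V) (x y : V) : Prop where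
  disjoint : Disjoint A B
  left_connected : (G.induce (A : Set V)).Connected
  right_connected : (G.induce (B : Set V)).Connected
  left_mem : x ∈ A
  right_mem : y ∈ B
  adj : G.Adj x y
  eq_of_adj : ∀ a ∈ A, ∀ b ∈ B, G.Adj a b → a = x ∧ b = y

theorem connected_union_of_adj {A B : Finset V} {x y : V}
    (hA : (G.induce (A : Set V)).Connected) (hB : (G.induce (B : Set V)).Connected)
    (hx : x ∈ A) (hy : y ∈ B) (h : G.Adj x y) :
    (G.induce ((A ∪ B : Finset V) : Set V)).Connected := by
  have hx' : x ∈ ((A ∪ B : Finset V) : Set V) := by simp [hx]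
  have hy' : y ∈ ((A ∪ B : Finset V) : Set V) := by simp [hy]
  have h1 : (A : Set V) ⊆ G.componentIn ((A ∪ B : Finset V) : Set V) x :=
    hA.subset_of_closed (fun a ha b hb => componentIn_closed a ha b (by simp_all)) hx
      (self_mem_componentIn hx')
  have h2 : (B : Set V) ⊆ G.componentIn ((A ∪ B : Finset V) : Set V) x :=
    hB.subset_of_closed (fun a ha b hb => componentIn_closed a ha b (by simp_all)) hy
      (componentIn_closed x (h1 hx) y hy' h)
  refine connected_of_subset_componentIn hx' ?_
  intro z hz
  obtain hz | hz := Finset.mem_union.1 hz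
  exacts [h1 hz, h2 hz]

theorem IsEdgeSplit.connected {A B : Finset V} {x y : V} (h : G.IsEdgeSplit A B x y) :
    (G.induce ((A ∪ B : Finset V) : Set V)).Connected :=
  connected_union_of_adj h.left_connected h.right_connected h.left_mem h.right_mem h.adj

theorem IsAcyclic.exists_isEdgeSplit (hG : G.IsAcyclic) {S : Finset V}
    (hS : (G.induce (S : Set V)).Connected) {x y : V} (hx : x ∈ S) (hy : y ∈ S)
    (hxy : G.Adj x y) : ∃ A B, A ∪ B = S ∧ G.IsEdgeSplit A B x y := by
  set B := G.componentIn ((S : Set V) \ {x}) y with hB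
  have hyU : y ∈ (S : Set V) \ {x} := ⟨hy, hxy.ne'⟩
  have hBU : (B : Set V) ⊆ (S : Set V) \ {x} := componentIn_subset
  have hyB : y ∈ B := self_mem_componentIn hyU
  have hxB : x ∉ B := fun h => (hBU h).2 rfl
  have hclB : ∀ b ∈ B, ∀ s ∈ S, G.Adj b s → s = x ∨ s ∈ B := by
    intro b hb s hs hbs
    by_cases hsx : s = x
    · exact .inl hsx
    · exact .inr (componentIn_closed b hb s ⟨hs, hsx⟩ hbs)
  have hxA : x ∈ S \ B := by simp [hx, hxB]
  have huniq : ∀ b ∈ B, G.Adj x b → b = y := by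
    intro b hb hxb
    by_contra hne
    have hbr := (isAcyclic_iff_forall_adj_isBridge.1 hG) hxb
    rw [isBridge_iff] at hbr
    apply hbr
    obtain ⟨_, _, h⟩ := mem_componentIn.1 hb
    have h1 : (G.deleteEdges {s(x, b)}).Adj x y := by
      simp [deleteEdges_adj, hxy, Ne.symm hne, hxb.ne]
    refine h1.reachable.trans ?_
    let φ : G.induce ((S : Set V) \ {x}) →g G.deleteEdges {s(x, b)} :=
      { toFun := Subtype.val
        map_rel' := by
          rintro ⟨u, hu⟩ ⟨v, hv⟩ huv
          have h1 : u ≠ x := hu.2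
          have h2 : v ≠ x := hv.2
          have h3 : G.Adj u v := huv
          simp [deleteEdges_adj, h3, h1, h2] }
    exact h.map φ
  refine ⟨S \ B, B, ?_, Finset.sdiff_disjoint, ?_, componentIn_connected hyU, hxA, hyB, hxy, ?_⟩
  · exact Finset.sdiff_union_of_subset fun b hb => (hBU hb).1
  · refine connected_of_subset_componentIn hxA fun z hz => ?_
    set R := G.componentIn ((S \ B : Finset V) : Set V) x
    have hxR : x ∈ R := self_mem_componentIn hxA
    have : (S : Set V) ⊆ (R : Set V) ∪ B := by
      refine hS.subset_of_closed ?_ hx (.inl hxR)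
      rintro a (ha | ha) b hb hab
      · by_cases hbB : b ∈ B
        · exact .inr hbB
        · exact .inl (componentIn_closed a ha b (by simpa [hbB] using hb) hab)
      · obtain rfl | h := hclB a ha b hb hab
        · exact .inl hxR
        · exact .inr h
    have hz' : z ∈ S ∧ z ∉ B := by simpa using hz
    exact (this hz'.1).resolve_right hz'.2
  · intro a ha b hb hab
    have ha' : a ∈ S ∧ a ∉ B := by simpa using ha
    obtain rfl := (hclB b hb a ha'.1 hab.symm).resolve_right ha'.2
    exact ⟨rfl, huniq b hb hab⟩


theorem IsEdgeSplit.prune_left {A B : Finset V} {x y v : V} (h : G.IsEdgeSplit A B x y)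
    (hvA : v ∈ A) (hvx : v ≠ x) :
    G.IsEdgeSplit (G.componentIn ((A : Set V) \ {v}) x) B x y ∧
      G.componentIn (((A ∪ B : Finset V) : Set V) \ {v}) x =
        G.componentIn ((A : Set V) \ {v}) x ∪ B := by
  have hx : x ∈ (A : Set V) \ {v} := ⟨h.left_mem, hvx.symm⟩
  have hsub : ∀ a ∈ G.componentIn ((A : Set V) \ {v}) x, a ∈ A ∧ a ≠ v := fun a ha =>
    componentIn_subset (U := (A : Set V) \ {v}) ha
  have hvB : v ∉ B := Finset.disjoint_left.1 h.disjoint hvA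
  have hs : G.IsEdgeSplit (G.componentIn ((A : Set V) \ {v}) x) B x y :=
    ⟨h.disjoint.mono_left fun a ha => (hsub a ha).1, componentIn_connected hx, h.right_connected,
      self_mem_componentIn hx, h.right_mem, h.adj, fun a ha => h.eq_of_adj a (hsub a ha).1⟩
  refine ⟨hs, componentIn_eq (Finset.mem_union_left _ hs.left_mem) ?_ hs.connected ?_⟩
  · intro a ha
    obtain ha | ha := Finset.mem_union.1 ha
    · exact ⟨Finset.mem_union_left _ (hsub a ha).1, (hsub a ha).2⟩
    · exact ⟨Finset.mem_union_right _ ha, fun e => hvB (e ▸ ha)⟩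
  · rintro a ha b ⟨hb, hbv⟩ hab
    obtain hb | hb := Finset.mem_union.1 hb
    · obtain ha | ha := Finset.mem_union.1 ha
      · exact Finset.mem_union_left _ (componentIn_closed a ha b ⟨hb, hbv⟩ hab)
      · rw [(h.eq_of_adj b hb a ha hab.symm).1]
        exact Finset.mem_union_left _ hs.left_mem
    · exact Finset.mem_union_right _ hb

theorem IsEdgeSplit.prune_right {A B : Finset V} {x y v : V} (h : G.IsEdgeSplit A B x y)
    (hvB : v ∈ B) (hvy : v ≠ y) :
    G.IsEdgeSplit A (G.componentIn ((B : Set V) \ {v}) y) x y ∧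
      G.componentIn (((A ∪ B : Finset V) : Set V) \ {v}) x =
        A ∪ G.componentIn ((B : Set V) \ {v}) y := by
  have hy : y ∈ (B : Set V) \ {v} := ⟨h.right_mem, hvy.symm⟩
  have hsub : ∀ b ∈ G.componentIn ((B : Set V) \ {v}) y, b ∈ B ∧ b ≠ v := fun b hb =>
    componentIn_subset (U := (B : Set V) \ {v}) hb
  have hvA : v ∉ A := Finset.disjoint_right.1 h.disjoint hvB
  have hs : G.IsEdgeSplit A (G.componentIn ((B : Set V) \ {v}) y) x y :=
    ⟨h.disjoint.mono_right fun b hb => (hsub b hb).1, h.left_connected, componentIn_connected hy,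
      h.left_mem, self_mem_componentIn hy, h.adj, fun a ha b hb => h.eq_of_adj a ha b (hsub b hb).1⟩
  refine ⟨hs, componentIn_eq (Finset.mem_union_left _ hs.left_mem) ?_ hs.connected ?_⟩
  · intro a ha
    obtain ha | ha := Finset.mem_union.1 ha
    · exact ⟨Finset.mem_union_left _ ha, fun e => hvA (e ▸ ha)⟩
    · exact ⟨Finset.mem_union_right _ (hsub a ha).1, (hsub a ha).2⟩
  · rintro a ha b ⟨hb, hbv⟩ hab
    obtain hb | hb := Finset.mem_union.1 hb
    · exact Finset.mem_union_left _ hb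
    · obtain ha | ha := Finset.mem_union.1 ha
      · rw [(h.eq_of_adj a ha b hb hab).2]
        exact Finset.mem_union_right _ hs.right_mem
      · exact Finset.mem_union_right _ (componentIn_closed a ha b ⟨hb, hbv⟩ hab)

theorem IsEdgeSplit.prune_root {A B : Finset V} {x y : V} (h : G.IsEdgeSplit A B x y) :
    G.componentIn (((A ∪ B : Finset V) : Set V) \ {y}) x = A := by
  have hyA : y ∉ A := Finset.disjoint_right.1 h.disjoint h.right_mem
  refine componentIn_eq h.left_mem ?_ h.left_connected ?_
  · exact fun a ha => ⟨Finset.mem_union_left _ ha, fun e => hyA (e ▸ ha)⟩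
  · rintro a ha b ⟨hb, hbv⟩ hab
    obtain hb | hb := Finset.mem_union.1 hb
    · exact hb
    · exact absurd (h.eq_of_adj a ha b hb hab).2 hbv

/-- `G.IsRootPoly S x p`: the polynomial `p` is attached to the subtree `S` rooted at `x`. Deleting
the vertices of `S` at independent uniform times in `[0, 1]`, `p.eval u` is the expected value of
`(-1) ^ k`, where `k` counts the `v ∈ S \ {x}` that are deleted before time `1 - u` and before the
other vertices on the path from `v` to `x`. -/
inductive IsRootPoly (G : SimpleGraph V) : Finset V → V → ℝ[X] → Prop
  | single (x : V) : IsRootPoly G {x} x 1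
  | join {A B : Finset V} {x y : V} {p K : ℝ[X]} (h : G.IsEdgeSplit A B x y)
      (hp : IsRootPoly G A x p) (hK : IsRootPoly G B y (derivative K)) (hK1 : K.eval 1 = 0) :
      IsRootPoly G (A ∪ B) x (p * derivative (X * K))

theorem exists_derivative_eq (p : ℝ[X]) : ∃ K : ℝ[X], derivative K = p ∧ K.eval 1 = 0 := by
  suffices h : ∃ K : ℝ[X], derivative K = p by
    obtain ⟨K, hK⟩ := h
    exact ⟨K - C (K.eval 1), by simp [hK], by simp⟩
  induction p using Polynomial.induction_on' with
  | add p q hp hq =>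
    obtain ⟨K, rfl⟩ := hp
    obtain ⟨L, rfl⟩ := hq
    exact ⟨K + L, by simp⟩
  | monomial n a =>
    refine ⟨monomial (n + 1) (a / (n + 1)), ?_⟩
    rw [derivative_monomial]
    congr 1
    push_cast
    field_simp

theorem eq_of_derivative_eq {p q : ℝ[X]} (h : derivative p = derivative q)
    (h1 : p.eval 1 = q.eval 1) : p = q := by
  have h2 : derivative (p - q) = 0 := by simp [h]
  rw [← sub_eq_zero, eq_C_of_derivative_eq_zero h2]
  have h3 := congrArg (eval 1) (eq_C_of_derivative_eq_zero h2)
  simp only [eval_sub, h1, sub_self, eval_C] at h3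
  rw [← h3, C_0]

namespace IsRootPoly

variable {S : Finset V} {x : V} {p : ℝ[X]}

omit [Fintype V] in
theorem root_mem (h : G.IsRootPoly S x p) : x ∈ S := by
  induction h with
  | single x => simp
  | join h => exact Finset.mem_union_left _ h.left_mem

omit [Fintype V] in
theorem eval_one (h : G.IsRootPoly S x p) : p.eval 1 = 1 := by
  induction h with
  | single x => simp
  | join h _ _ hK1 ihp ihK => simp [ihp, ihK, hK1]

theorem exists_prune (h : G.IsRootPoly S x p) : ∃ q : V → ℝ[X],
    (∀ v ∈ S.erase x, G.IsRootPoly (G.componentIn ((S : Set V) \ {v}) x) x (q v)) ∧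
      X * derivative p = (S.card - 1 : ℝ[X]) * p + ∑ v ∈ S.erase x, q v := by
  induction h with
  | single x => exact ⟨0, by simp, by simp⟩
  | @join A B x y p K h hp hK hK1 ihp ihK =>
    obtain ⟨qA, hqA, hpA⟩ := ihp
    obtain ⟨qB, hqB, hpB⟩ := ihK
    choose L hL hL1 using fun v => exists_derivative_eq (qB v)
    have hxB : x ∉ B := Finset.disjoint_left.1 h.disjoint h.left_mem
    have hdisj : ∀ {v}, v ∈ B → v ∉ A := fun hv => Finset.disjoint_right.1 h.disjoint hv
    have hsumL : ∑ v ∈ B.erase y, L v = X * derivative K - (B.card : ℝ[X]) * K - 1 := by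
      apply eq_of_derivative_eq
      · rw [derivative_sum, Finset.sum_congr rfl fun v _ => hL v]
        simp only [derivative_sub, derivative_mul, derivative_X, derivative_natCast,
          derivative_one]
        linear_combination -hpB
      · simp [eval_finsetSum, hL1, hK.eval_one, hK1]
    refine ⟨fun v => if v ∈ A then qA v * derivative (X * K) else
      if v = y then p else p * derivative (X * L v), ?_, ?_⟩
    · intro v hv
      obtain ⟨hvx, hv⟩ := Finset.mem_erase.1 hv
      by_cases hvA : v ∈ A
      · obtain ⟨hs, heq⟩ := h.prune_left hvA hvx
        rw [heq]
        simpa only [if_pos hvA] using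
          IsRootPoly.join hs (hqA v (Finset.mem_erase.2 ⟨hvx, hvA⟩)) hK hK1
      · have hvB : v ∈ B := (Finset.mem_union.1 hv).resolve_left hvA
        by_cases hvy : v = y
        · subst hvy
          rw [h.prune_root]
          simpa only [if_neg hvA, if_true] using hp
        · obtain ⟨hs, heq⟩ := h.prune_right hvB hvy
          rw [heq]
          simp only [if_neg hvA, if_neg hvy]
          refine .join hs hp ?_ (hL1 v)
          rw [hL]
          exact hqB v (Finset.mem_erase.2 ⟨hvy, hvB⟩)
    · have hers : (A ∪ B).erase x = A.erase x ∪ B := by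
        rw [Finset.erase_union_distrib, Finset.erase_eq_of_notMem hxB]
      rw [hers, Finset.sum_union (h.disjoint.mono_left (Finset.erase_subset _ _)),
        Finset.card_union_of_disjoint h.disjoint, ← Finset.add_sum_erase B _ h.right_mem]
      have e1 : ∑ v ∈ A.erase x, (if v ∈ A then qA v * derivative (X * K) else
          if v = y then p else p * derivative (X * L v)) =
          (∑ v ∈ A.erase x, qA v) * derivative (X * K) := by
        rw [Finset.sum_mul]
        exact Finset.sum_congr rfl fun v hv => if_pos (Finset.mem_of_mem_erase hv)
      have e2 : ∑ v ∈ B.erase y, (if v ∈ A then qA v * derivative (X * K) else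
          if v = y then p else p * derivative (X * L v)) =
          p * (∑ v ∈ B.erase y, L v + X * ∑ v ∈ B.erase y, qB v) := by
        rw [Finset.mul_sum, ← Finset.sum_add_distrib, Finset.mul_sum]
        refine Finset.sum_congr rfl fun v hv => ?_
        obtain ⟨hvy, hvB⟩ := Finset.mem_erase.1 hv
        rw [if_neg (hdisj hvB), if_neg hvy, derivative_mul, hL, derivative_X, one_mul]
      rw [e1, e2, if_neg (hdisj h.right_mem), if_pos rfl, hsumL]
      simp only [derivative_mul, derivative_X, derivative_add, one_mul, Nat.cast_add]
      linear_combination (K + X * derivative K) * hpA + p * X * hpB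

end IsRootPoly

theorem IsAcyclic.exists_isRootPoly (hG : G.IsAcyclic) {S : Finset V}
    (hS : (G.induce (S : Set V)).Connected) {x : V} (hx : x ∈ S) :
    ∃ p, G.IsRootPoly S x p := by
  induction hn : S.card using Nat.strong_induction_on generalizing S x with
  | _ n ih =>
    by_cases hy : ∃ y ∈ S, G.Adj x y
    · obtain ⟨y, hy, hxy⟩ := hy
      obtain ⟨A, B, rfl, h⟩ := hG.exists_isEdgeSplit hS hx hy hxy
      have hc := Finset.card_union_of_disjoint h.disjoint
      have hA := Finset.card_pos.2 ⟨x, h.left_mem⟩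
      have hB := Finset.card_pos.2 ⟨y, h.right_mem⟩
      obtain ⟨p, hp⟩ := ih A.card (by omega) h.left_connected h.left_mem rfl
      obtain ⟨q, hq⟩ := ih B.card (by omega) h.right_connected h.right_mem rfl
      obtain ⟨K, rfl, hK1⟩ := exists_derivative_eq q
      exact ⟨_, .join h hp hq hK1⟩
    · push Not at hy
      obtain rfl := hS.eq_singleton_of_forall_not_adj hx hy
      exact ⟨1, .single x⟩


/-- The integral of a real polynomial over `[0, 1]`. -/
noncomputable def unitIntegral : ℝ[X] →ₗ[ℝ] ℝ where
  toFun p := ∫ u in (0 : ℝ)..1, p.eval u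
  map_add' p q := by
    simp only [eval_add]
    exact intervalIntegral.integral_add (p.continuous.intervalIntegrable _ _)
      (q.continuous.intervalIntegrable _ _)
  map_smul' c p := by simp

theorem unitIntegral_derivative (p : ℝ[X]) :
    unitIntegral (derivative p) = p.eval 1 - p.eval 0 :=
  intervalIntegral.integral_eq_sub_of_hasDerivAt (fun u _ => p.hasDerivAt u)
    (p.derivative.continuous.intervalIntegrable _ _)

theorem unitIntegral_mono {p q : ℝ[X]} (h : ∀ u ∈ Set.Icc (0 : ℝ) 1, p.eval u ≤ q.eval u) :
    unitIntegral p ≤ unitIntegral q :=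
  intervalIntegral.integral_mono_on zero_le_one (p.continuous.intervalIntegrable _ _)
    (q.continuous.intervalIntegrable _ _) h

theorem unitIntegral_X_pow (n : ℕ) : unitIntegral (X ^ n) = 1 / (n + 1) := by
  simp [unitIntegral]

theorem unitIntegral_natCast_mul (n : ℕ) (p : ℝ[X]) :
    unitIntegral (n * p) = n * unitIntegral p := by
  rw [← nsmul_eq_mul, map_nsmul, nsmul_eq_mul]

/-- The weighted `L²` norm of the factor `derivative (X * K)` contributed by a branch. -/
noncomputable def branchNorm (m : ℕ) (K : ℝ[X]) : ℝ :=
  unitIntegral (X ^ m * derivative (X * K) ^ 2)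

theorem branchNorm_le (m : ℕ) {K : ℝ[X]} (hK1 : K.eval 1 = 0) :
    branchNorm m K ≤ unitIntegral (X ^ (m + 2) * derivative K ^ 2) := by
  have key : (X ^ m * derivative (X * K) ^ 2 : ℝ[X]) =
      X ^ (m + 2) * derivative K ^ 2 - (m : ℝ[X]) * (X ^ m * K ^ 2) +
        derivative (X ^ (m + 1) * K ^ 2) := by
    simp only [derivative_mul, derivative_X, derivative_pow, map_natCast, Nat.add_sub_cancel]
    push_cast
    ring
  have hnn : 0 ≤ unitIntegral (X ^ m * K ^ 2) := by
    rw [← map_zero unitIntegral]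
    refine unitIntegral_mono fun u hu => ?_
    have := hu.1
    simp only [eval_zero, eval_mul, eval_pow, eval_X]
    positivity
  rw [branchNorm, key, map_add, map_sub, unitIntegral_derivative, unitIntegral_natCast_mul]
  have : (0 : ℝ) ≤ m * unitIntegral (X ^ m * K ^ 2) := by positivity
  simp [hK1]
  exact this

theorem branchNorm_of_derivative_eq_one (m : ℕ) {K : ℝ[X]} (hK : derivative K = 1)
    (hK1 : K.eval 1 = 0) :
    branchNorm m K = 4 / (m + 3) - 4 / (m + 2) + 1 / (m + 1) := by
  obtain rfl : K = X - 1 := eq_of_derivative_eq (by simp [hK]) (by simp [hK1])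
  have : (X ^ m * derivative (X * (X - 1)) ^ 2 : ℝ[X]) =
      (4 : ℝ) • X ^ (m + 2) - (4 : ℝ) • X ^ (m + 1) + X ^ m := by
    simp only [derivative_mul, derivative_X, derivative_sub, derivative_one, smul_eq_C_mul,
      map_ofNat]
    ring
  rw [branchNorm, this, map_add, map_sub, map_smul, map_smul, unitIntegral_X_pow,
    unitIntegral_X_pow, unitIntegral_X_pow]
  push_cast
  simp only [smul_eq_mul]
  ring

theorem abs_eval_derivative_le_one {K : ℝ[X]} (hK1 : K.eval 1 = 0)
    (hK : ∀ u ∈ Set.Icc (0 : ℝ) 1, |(derivative K).eval u| ≤ 1) {u : ℝ}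
    (hu : u ∈ Set.Icc (0 : ℝ) 1) : |(derivative (X * K)).eval u| ≤ 1 := by
  have h1 : ‖K.eval 1 - K.eval u‖ ≤ 1 * ‖1 - u‖ :=
    (convex_Icc (0 : ℝ) 1).norm_image_sub_le_of_norm_deriv_le (f := fun t => K.eval t)
      (fun t _ => K.differentiableAt) (fun t ht => by simpa using hK t ht) hu (by simp)
  rw [hK1, zero_sub, norm_neg, one_mul, Real.norm_eq_abs, Real.norm_eq_abs,
    abs_of_nonneg (sub_nonneg.2 hu.2)] at h1
  have h2 := hK u hu
  have h3 : |u * (derivative K).eval u| ≤ u := by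
    rw [abs_mul, abs_of_nonneg hu.1]
    exact mul_le_of_le_one_right hu.1 h2
  simp only [derivative_mul, derivative_X, one_mul, eval_add, eval_mul, eval_X]
  exact (abs_add_le _ _).trans (by linarith)

namespace IsRootPoly

variable {S : Finset V} {x : V} {p : ℝ[X]}

omit [Fintype V] in
theorem abs_eval_le_one (h : G.IsRootPoly S x p) :
    ∀ u ∈ Set.Icc (0 : ℝ) 1, |p.eval u| ≤ 1 := by
  induction h with
  | single x => simp
  | join h _ _ hK1 ihp ihK =>
    intro u hu
    rw [eval_mul, abs_mul]
    exact mul_le_one₀ (ihp u hu) (abs_nonneg _) (abs_eval_derivative_le_one hK1 ihK hu)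

omit [Fintype V] in
/-- A root polynomial is `1` or is dominated by the factor of one of its branches. -/
theorem eq_one_or_exists_branch (h : G.IsRootPoly S x p) : (S.card = 1 ∧ p = 1) ∨
    ∃ (B : Finset V) (y : V) (K : ℝ[X]), G.IsRootPoly B y (derivative K) ∧ K.eval 1 = 0 ∧
      ∀ u ∈ Set.Icc (0 : ℝ) 1, p.eval u ^ 2 ≤ (derivative (X * K)).eval u ^ 2 := by
  cases h with
  | single => exact .inl ⟨by simp, rfl⟩
  | @join A B _ y p K h hp hK hK1 =>
    refine .inr ⟨B, y, K, hK, hK1, fun u hu => ?_⟩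
    rw [eval_mul, mul_pow]
    exact mul_le_of_le_one_left (sq_nonneg _) ((sq_le_one_iff_abs_le_one _).2
      (hp.abs_eval_le_one u hu))

omit [Fintype V] in
theorem unitIntegral_X_pow_mul_sq_le (h : G.IsRootPoly S x p) (m : ℕ) :
    unitIntegral (X ^ m * p ^ 2) ≤ 1 / (m + 1) := by
  rw [← unitIntegral_X_pow]
  refine unitIntegral_mono fun u hu => ?_
  simp only [eval_mul, eval_pow, eval_X]
  exact mul_le_of_le_one_right (pow_nonneg hu.1 m) ((sq_le_one_iff_abs_le_one _).2
    (h.abs_eval_le_one u hu))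

omit [Fintype V] in
theorem branchNorm_le_one_div {K : ℝ[X]} (h : G.IsRootPoly S x (derivative K))
    (hK1 : K.eval 1 = 0) (m : ℕ) : branchNorm m K ≤ 1 / (m + 3) := by
  refine (branchNorm_le m hK1).trans ((h.unitIntegral_X_pow_mul_sq_le _).trans_eq ?_)
  push_cast
  ring

omit [Fintype V] in
theorem derivative_eq_one_or_branchNorm_le {K : ℝ[X]} (h : G.IsRootPoly S x (derivative K))
    (hK1 : K.eval 1 = 0) (m : ℕ) : (S.card = 1 ∧ derivative K = 1) ∨
    ∃ (B : Finset V) (y : V) (L : ℝ[X]), G.IsRootPoly B y (derivative L) ∧ L.eval 1 = 0 ∧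
      branchNorm m K ≤ branchNorm (m + 2) L := by
  refine h.eq_one_or_exists_branch.imp_right ?_
  rintro ⟨B, y, L, hL, hL1, hle⟩
  refine ⟨B, y, L, hL, hL1, (branchNorm_le m hK1).trans (unitIntegral_mono fun u hu => ?_)⟩
  simp only [eval_mul, eval_pow, eval_X]
  exact mul_le_mul_of_nonneg_left (hle u hu) (pow_nonneg hu.1 _)

omit [Fintype V] in
theorem branchNorm_le_two_fifteenths {K : ℝ[X]} (h : G.IsRootPoly S x (derivative K))
    (hK1 : K.eval 1 = 0) (hS : S.card ≠ 1) : branchNorm 0 K ≤ 2 / 15 := by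
  obtain ⟨hS', -⟩ | ⟨B, y, L, hL, hL1, hle⟩ := h.derivative_eq_one_or_branchNorm_le hK1 0
  · exact absurd hS' hS
  refine hle.trans ?_
  obtain ⟨-, hL'⟩ | ⟨B, y, M, hM, hM1, hle⟩ := hL.derivative_eq_one_or_branchNorm_le hL1 (0 + 2)
  · rw [branchNorm_of_derivative_eq_one _ hL' hL1]
    norm_num
  refine hle.trans ?_
  obtain ⟨-, hM'⟩ | ⟨B, y, N, hN, hN1, hle⟩ :=
    hM.derivative_eq_one_or_branchNorm_le hM1 (0 + 2 + 2)
  · rw [branchNorm_of_derivative_eq_one _ hM' hM1]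
    norm_num
  refine hle.trans ((hN.branchNorm_le_one_div hN1 _).trans ?_)
  norm_num

omit [Fintype V] in
theorem card_mul_unitIntegral {q : V → ℝ[X]} (h : G.IsRootPoly S x p)
    (hq : X * derivative p = (S.card - 1 : ℝ[X]) * p + ∑ v ∈ S.erase x, q v) :
    S.card * unitIntegral p + ∑ v ∈ S.erase x, unitIntegral (q v) = 1 := by
  have key : derivative (X * p) = (S.card : ℝ[X]) * p + ∑ v ∈ S.erase x, q v := by
    simp only [derivative_mul, derivative_X]
    linear_combination hq
  have := congrArg unitIntegral key
  rw [unitIntegral_derivative, map_add, unitIntegral_natCast_mul, map_sum] at this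
  simpa [h.eval_one] using this.symm

end IsRootPoly

omit [Fintype V] in
theorem IsEdgeSplit.card_right_ne_one {A B : Finset V} {x y z : V} (h : G.IsEdgeSplit A B x y)
    (hz : z ∈ A ∪ B) (hyz : G.Adj y z) (hzx : z ≠ x) : B.card ≠ 1 := by
  have hzB : z ∈ B := by
    refine (Finset.mem_union.1 hz).resolve_left fun hzA => hzx ?_
    exact (h.eq_of_adj z hzA y h.right_mem hyz.symm).1
  intro hB
  exact hyz.ne (Finset.card_le_one.1 hB.le y h.right_mem z hzB)

theorem IsAcyclic.exists_branch (hG : G.IsAcyclic) {A B : Finset V} {x y : V}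
    (h : G.IsEdgeSplit A B x y) : ∃ K : ℝ[X], K.eval 1 = 0 ∧
      G.IsRootPoly B y (derivative K) ∧ branchNorm 0 K ≤ 1 / 3 ∧
      ((∃ z ∈ A ∪ B, G.Adj y z ∧ z ≠ x) → branchNorm 0 K ≤ 2 / 15) := by
  obtain ⟨q, hq⟩ := hG.exists_isRootPoly h.right_connected h.right_mem
  obtain ⟨K, rfl, hK1⟩ := exists_derivative_eq q
  refine ⟨K, hK1, hq, by simpa using hq.branchNorm_le_one_div hK1 0, ?_⟩
  rintro ⟨z, hz, hyz, hzx⟩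
  exact hq.branchNorm_le_two_fifteenths hK1 (h.card_right_ne_one hz hyz hzx)

omit [DecidableEq V] in
theorem Connected.induce_coe_univ (hG : G.Connected) :
    (G.induce ((Finset.univ : Finset V) : Set V)).Connected := by
  rw [Finset.coe_univ]
  exact (induceUnivIso G).connected_iff.2 hG

variable [DecidableRel G.Adj]

theorem IsTree.exists_isRootPoly_of_degree_eq_one (hG : G.IsTree) {x : V} (hx : G.degree x = 1) :
    ∃ p, G.IsRootPoly Finset.univ x p ∧ unitIntegral p = 0 := by
  obtain ⟨y, hxy, huniq⟩ := degree_eq_one_iff_existsUnique_adj.1 hx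
  obtain ⟨A, B, hAB, h⟩ := hG.isAcyclic.exists_isEdgeSplit hG.connected.induce_coe_univ (Finset.mem_univ x)
    (Finset.mem_univ y) hxy
  obtain ⟨K, hK1, hK, -⟩ := hG.isAcyclic.exists_branch h
  obtain rfl : A = {x} := by
    refine h.left_connected.eq_singleton_of_forall_not_adj h.left_mem fun z hz hxz => ?_
    rw [huniq z hxz] at hz
    exact Finset.disjoint_left.1 h.disjoint hz h.right_mem
  have hp := IsRootPoly.join h (.single x) hK hK1
  rw [hAB] at hp
  refine ⟨_, hp, ?_⟩
  rw [one_mul, unitIntegral_derivative]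
  simp [hK1]

omit [DecidableEq V] in
theorem exists_adj_ne_of_one_lt_degree {x : V} (h : 1 < G.degree x) (y : V) :
    ∃ z, G.Adj x z ∧ z ≠ y := by
  obtain ⟨z, hz, hne⟩ := Finset.exists_mem_ne h y
  exact ⟨z, by simpa using hz, hne⟩

theorem IsTree.exists_isRootPoly_of_one_lt_degree (hG : G.IsTree) [Nontrivial V] {x : V}
    (hx : 1 < G.degree x) : ∃ p, G.IsRootPoly Finset.univ x p ∧
      |unitIntegral p| ≤ 2 / 15 + ((G.neighborFinset x).filter (G.degree · = 1)).card / 10 := by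
  obtain ⟨y₁, hy₁, y₂, hy₂, hne⟩ := Finset.one_lt_card.1 hx
  rw [mem_neighborFinset] at hy₁ hy₂
  obtain ⟨A, B, hAB, h₁⟩ := hG.isAcyclic.exists_isEdgeSplit hG.connected.induce_coe_univ (Finset.mem_univ x)
    (Finset.mem_univ y₁) hy₁
  have hy₂A : y₂ ∈ A := by
    refine (Finset.mem_union.1 (hAB ▸ Finset.mem_univ y₂)).resolve_right fun hB => hne ?_
    exact (h₁.eq_of_adj x h₁.left_mem y₂ hB hy₂).2.symm
  obtain ⟨A', B', rfl, h₂⟩ := hG.isAcyclic.exists_isEdgeSplit h₁.left_connected h₁.left_mem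
    hy₂A hy₂
  obtain ⟨K₁, hK₁1, hK₁, hle₁, hle₁'⟩ := hG.isAcyclic.exists_branch h₁
  obtain ⟨K₂, hK₂1, hK₂, hle₂, hle₂'⟩ := hG.isAcyclic.exists_branch h₂
  obtain ⟨r, hr⟩ := hG.isAcyclic.exists_isRootPoly h₂.left_connected h₂.left_mem
  have hN : ∀ {y : V} {N : ℝ}, N ≤ 1 / 3 → (1 < G.degree y → N ≤ 2 / 15) →
      N ≤ 2 / 15 + (if G.degree y = 1 then 1 else 0) / 5 := by
    intro y N h1 h2
    split_ifs with hy
    · linarith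
    · have := hG.connected.preconnected.degree_pos_of_nontrivial y
      have := h2 (by omega)
      linarith
  have hN₁ := hN (y := y₁) hle₁ fun hdeg => hle₁' <| by
    obtain ⟨z, hz, hzx⟩ := exists_adj_ne_of_one_lt_degree hdeg x
    exact ⟨z, hAB ▸ Finset.mem_univ z, hz, hzx⟩
  have hN₂ := hN (y := y₂) hle₂ fun hdeg => hle₂' <| by
    obtain ⟨z, hz, hzx⟩ := exists_adj_ne_of_one_lt_degree hdeg x
    refine ⟨z, (Finset.mem_union.1 (hAB ▸ Finset.mem_univ z)).resolve_right fun hzB => ?_, hz, hzx⟩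
    exact hy₂.ne (h₁.eq_of_adj y₂ hy₂A z hzB hz).1.symm
  have hcard : ((if G.degree y₁ = 1 then 1 else 0) + (if G.degree y₂ = 1 then 1 else 0) : ℝ) ≤
      ((G.neighborFinset x).filter (G.degree · = 1)).card := by
    have hsub : ({y₁, y₂} : Finset V) ⊆ G.neighborFinset x := by
      simp [Finset.insert_subset_iff, hy₁, hy₂]
    have := Finset.card_le_card (Finset.filter_subset_filter (G.degree · = 1) hsub)
    rw [Finset.card_filter, Finset.sum_pair hne] at this
    exact_mod_cast this
  have hp := IsRootPoly.join h₁ (.join h₂ hr hK₂ hK₂1) hK₁ hK₁1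
  rw [hAB] at hp
  refine ⟨_, hp, ?_⟩
  set f₁ := derivative (X * K₁)
  set f₂ := derivative (X * K₂)
  have hint : |unitIntegral (r * f₂ * f₁)| ≤ (branchNorm 0 K₁ + branchNorm 0 K₂) / 2 := by
    have hJ : (branchNorm 0 K₁ + branchNorm 0 K₂) / 2 =
        unitIntegral ((1 / 2 : ℝ) • (f₁ ^ 2 + f₂ ^ 2)) := by
      simp only [branchNorm, map_smul, map_add, pow_zero, one_mul, smul_eq_mul, f₁, f₂]
      ring
    have hle : ∀ u ∈ Set.Icc (0 : ℝ) 1, |(r * f₂ * f₁).eval u| ≤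
        ((1 / 2 : ℝ) • (f₁ ^ 2 + f₂ ^ 2)).eval u := by
      intro u hu
      simp only [eval_mul, eval_smul, eval_add, eval_pow, smul_eq_mul, mul_assoc]
      rw [abs_mul, abs_mul]
      refine (mul_le_of_le_one_left (by positivity) (hr.abs_eval_le_one u hu)).trans ?_
      rw [← sq_abs (f₁.eval u), ← sq_abs (f₂.eval u)]
      nlinarith [sq_nonneg (|f₁.eval u| - |f₂.eval u|)]
    rw [hJ, abs_le]
    constructor
    · rw [← map_neg]
      refine unitIntegral_mono fun u hu => ?_
      rw [eval_neg]
      exact (abs_le.1 (hle u hu)).1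
    · exact unitIntegral_mono fun u hu => (abs_le.1 (hle u hu)).2
  linarith

theorem IsTree.abs_sum_unitIntegral_lt (hG : G.IsTree) [Nontrivial V] :
    ∃ p : V → ℝ[X], (∀ x, G.IsRootPoly Finset.univ x (p x)) ∧
      |∑ x, unitIntegral (p x)| < 2 / 15 * Fintype.card V := by
  have hex : ∀ x, ∃ p, G.IsRootPoly Finset.univ x p ∧ |unitIntegral p| ≤
      if G.degree x = 1 then 0 else
        2 / 15 + (((G.neighborFinset x).filter (G.degree · = 1)).card : ℝ) / 10 := by
    intro x
    split_ifs with hx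
    · obtain ⟨p, hp, h0⟩ := hG.exists_isRootPoly_of_degree_eq_one hx
      exact ⟨p, hp, by simp [h0]⟩
    · have := hG.connected.preconnected.degree_pos_of_nontrivial x
      exact hG.exists_isRootPoly_of_one_lt_degree (by omega)
  choose p hp hle using hex
  refine ⟨p, hp, ((Finset.abs_sum_le_sum_abs _ _).trans
    (Finset.sum_le_sum fun x _ => hle x)).trans_lt ?_⟩
  set L : Finset V := Finset.univ.filter (G.degree · = 1) with hL
  have hLpos : 0 < (L.card : ℝ) := by
    obtain ⟨v, hv⟩ := hG.exists_vert_degree_one_of_nontrivial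
    exact_mod_cast Finset.card_pos.2 ⟨v, by simp [hL, hv]⟩
  have hcount : ∑ x, (((G.neighborFinset x).filter (G.degree · = 1)).card : ℝ) = L.card := by
    simp only [Finset.card_filter, neighborFinset_eq_filter, Finset.sum_filter]
    push_cast
    rw [Finset.sum_comm]
    rw [hL, Finset.card_filter]
    push_cast
    refine Finset.sum_congr rfl fun y _ => ?_
    by_cases hy : G.degree y = 1
    · have : (∑ x, if G.Adj x y then 1 else 0 : ℕ) = 1 := by
        simp only [G.adj_comm _ y]
        rw [← Finset.card_filter, ← neighborFinset_eq_filter, card_neighborFinset_eq_degree, hy]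
      simpa [hy] using congrArg (Nat.cast : ℕ → ℝ) this
    · simp [hy]
  have hcount' : ∑ x, (((G.neighborFinset x).filter (G.degree · = 1)).card : ℝ) / 10 =
      L.card / 10 := by
    rw [← Finset.sum_div, hcount]
  calc ∑ x, (if G.degree x = 1 then (0 : ℝ) else
        2 / 15 + (((G.neighborFinset x).filter (G.degree · = 1)).card : ℝ) / 10)
      ≤ ∑ x, (2 / 15 - (if G.degree x = 1 then 2 / 15 else 0) +
        (((G.neighborFinset x).filter (G.degree · = 1)).card : ℝ) / 10) := by
        refine Finset.sum_le_sum fun x _ => ?_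
        split_ifs
        · rw [sub_self, zero_add]
          positivity
        · linarith
    _ = 2 / 15 * Fintype.card V - 2 / 15 * L.card + L.card / 10 := by
        rw [Finset.sum_add_distrib, Finset.sum_sub_distrib, hcount',
          ← Finset.sum_filter]
        simp only [Finset.sum_const, nsmul_eq_mul, Finset.card_univ, ← hL]
        ring
    _ < 2 / 15 * Fintype.card V := by linarith

omit [DecidableEq V] [DecidableRel G.Adj] in
theorem coe_componentIn {U : Set V} (x : U) :
    (G.componentIn U x : Set V) =
      Subtype.val '' ((G.induce U).connectedComponentMk x).supp := by
  ext z
  simp only [Finset.mem_coe, mem_componentIn, Set.mem_image, ConnectedComponent.mem_supp_iff,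
    ConnectedComponent.eq]
  constructor
  · rintro ⟨_, hz, h⟩
    exact ⟨⟨z, hz⟩, h.symm, rfl⟩
  · rintro ⟨w, h, rfl⟩
    exact ⟨x.2, w.2, h.symm⟩

omit [DecidableEq V] [DecidableRel G.Adj] in
theorem finsum_connectedComponent_eq {W : Finset V} {U : Set V} (hWU : (W : Set V) = U)
    {Q : Set V → ℝ} {f : V → ℝ}
    (hQ : ∀ x ∈ W, Q (G.componentIn U x) = ∑ z ∈ G.componentIn U x, f z) :
    ∑ᶠ c : (G.induce U).ConnectedComponent, Q (Subtype.val '' c.supp) = ∑ z ∈ W, f z := by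
  classical
  subst hWU
  rw [finsum_eq_sum_of_fintype, Finset.sum_subtype W (p := (· ∈ (W : Set V))) (by simp) f,
    ← Finset.sum_fiberwise (s := Finset.univ) (g := (G.induce (W : Set V)).connectedComponentMk)]
  refine Finset.sum_congr rfl fun c _ => ?_
  induction c using ConnectedComponent.ind with
  | _ x =>
    rw [← coe_componentIn, hQ x x.2]
    refine (Finset.sum_bij (fun z _ => z.1) ?_ ?_ ?_ ?_).symm
    · intro z hz
      rw [← Finset.mem_coe, coe_componentIn]
      exact ⟨z, by simpa using hz, rfl⟩
    · exact fun a _ b _ h => Subtype.ext h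
    · intro z hz
      rw [← Finset.mem_coe, coe_componentIn] at hz
      obtain ⟨w, hw, rfl⟩ := hz
      exact ⟨w, by simpa using hw, rfl⟩
    · exact fun _ _ => rfl

omit [DecidableRel G.Adj] in
theorem card_mul_eq_sum_of_recursion {P : Set V → ℝ}
    (hP : ∀ S : Set V, S.Nonempty → (G.induce S).Connected →
      P S = 1 - (1 / (S.ncard : ℝ) ^ 2) *
        ∑ᶠ v : S, ∑ᶠ c : (G.induce (S \ {(v : V)})).ConnectedComponent,
          ((Subtype.val '' c.supp).ncard : ℝ) * P (Subtype.val '' c.supp))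
    {S : Finset V} (hne : S.Nonempty) (hS : (G.induce (S : Set V)).Connected) {p : V → ℝ[X]}
    (hp : ∀ x ∈ S, G.IsRootPoly S x (p x)) :
    (S.card : ℝ) * P S = ∑ x ∈ S, (1 + unitIntegral (p x)) / 2 := by
  induction hn : S.card using Nat.strong_induction_on generalizing S p with
  | _ n ih =>
    have hex : ∀ x, ∃ q : V → ℝ[X], x ∈ S →
        (∀ v ∈ S.erase x, G.IsRootPoly (G.componentIn ((S : Set V) \ {v}) x) x (q v)) ∧
          (n : ℝ) * unitIntegral (p x) + ∑ v ∈ S.erase x, unitIntegral (q v) = 1 := by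
      intro x
      by_cases hx : x ∈ S
      · obtain ⟨q, hq, hrec⟩ := (hp x hx).exists_prune
        exact ⟨q, fun _ => ⟨hq, hn ▸ (hp x hx).card_mul_unitIntegral hrec⟩⟩
      · exact ⟨0, fun h => absurd h hx⟩
    choose q hq using hex
    have hinner : ∀ v ∈ S, ∑ᶠ c : (G.induce ((S : Set V) \ {v})).ConnectedComponent,
        ((Subtype.val '' c.supp).ncard : ℝ) * P (Subtype.val '' c.supp) =
          ∑ x ∈ S.erase v, (1 + unitIntegral (q x v)) / 2 := by
      intro v hv
      refine finsum_connectedComponent_eq (Q := fun C => (C.ncard : ℝ) * P C)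
        (Finset.coe_erase v S) fun x hx => ?_
      have hxU : x ∈ (S : Set V) \ {v} := by simpa [and_comm] using hx
      have hsub : ∀ z ∈ G.componentIn ((S : Set V) \ {v}) x, z ∈ S ∧ z ≠ v := fun z hz =>
        componentIn_subset (U := (S : Set V) \ {v}) hz
      simp only [Set.ncard_coe_finset]
      refine ih _ ?_ ⟨x, self_mem_componentIn hxU⟩ (componentIn_connected hxU)
        (p := fun z => q z v) (fun z hz => ?_) rfl
      · rw [← hn]
        refine Finset.card_lt_card ⟨fun z hz => (hsub z hz).1, fun h => ?_⟩
        exact (hsub v (h hv)).2 rfl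
      · obtain ⟨hzS, hzv⟩ := hsub z hz
        have hcomp : G.componentIn ((S : Set V) \ {v}) z =
            G.componentIn ((S : Set V) \ {v}) x :=
          componentIn_eq hz componentIn_subset (componentIn_connected hxU) componentIn_closed
        rw [← hcomp]
        exact (hq z hzS).1 v (Finset.mem_erase.2 ⟨hzv.symm, hv⟩)
    have houter : ∑ᶠ v : (S : Set V),
        ∑ᶠ c : (G.induce ((S : Set V) \ {(v : V)})).ConnectedComponent,
          ((Subtype.val '' c.supp).ncard : ℝ) * P (Subtype.val '' c.supp) =
        n * ∑ x ∈ S, (1 - unitIntegral (p x)) / 2 := by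
      rw [finsum_congr fun v : (S : Set V) => hinner v v.2, finsum_set_coe_eq_finsum_mem (S : Set V)
        (f := fun v => ∑ x ∈ S.erase v, (1 + unitIntegral (q x v)) / 2), finsum_mem_coe_finset,
        Finset.sum_comm' (t' := S) (s' := fun x => S.erase x) (by
          intro a b
          simp only [Finset.mem_erase]
          tauto), Finset.mul_sum]
      refine Finset.sum_congr rfl fun x hx => ?_
      have hcard : ((S.erase x).card : ℝ) = n - 1 := by
        rw [Finset.card_erase_of_mem hx, hn, Nat.cast_sub (hn ▸ Finset.card_pos.2 hne),
          Nat.cast_one]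
      rw [← Finset.sum_div, Finset.sum_add_distrib, Finset.sum_const, nsmul_eq_mul, hcard]
      linear_combination (hq x hx).2 / 2
    have hn0 : (n : ℝ) ≠ 0 := by
      exact_mod_cast hn ▸ (Finset.card_pos.2 hne).ne'
    have hsum : ∑ x ∈ S, (1 + unitIntegral (p x)) / 2 =
        n - ∑ x ∈ S, (1 - unitIntegral (p x)) / 2 := by
      rw [eq_sub_iff_add_eq, ← Finset.sum_add_distrib, Finset.sum_congr rfl (g := fun _ => (1 : ℝ))
        (fun x _ => by ring)]
      simp [hn]
    rw [hP S hne hS, houter, hsum, Set.ncard_coe_finset, hn]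
    field_simp

end SimpleGraph

theorem stmt_19 {V : Type*} [Fintype V] (G : SimpleGraph V) (hG : G.IsTree)
    (hn : 2 ≤ Fintype.card V)
    (P : Set V → ℝ)
    (hP : ∀ S : Set V, S.Nonempty → (G.induce S).Connected →
      P S = 1 - (1 / (S.ncard : ℝ) ^ 2) *
        ∑ᶠ v : S, ∑ᶠ c : (G.induce (S \ {(v : V)})).ConnectedComponent,
          ((Subtype.val '' c.supp).ncard : ℝ) * P (Subtype.val '' c.supp)) :
    13 / 30 < P Set.univ ∧ P Set.univ < 17 / 30 := by
  classical
  have : Nontrivial V := Fintype.one_lt_card_iff_nontrivial.1 hn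
  obtain ⟨p, hp, hlt⟩ := hG.abs_sum_unitIntegral_lt
  have key := SimpleGraph.card_mul_eq_sum_of_recursion hP Finset.univ_nonempty
    hG.connected.induce_coe_univ fun x _ => hp x
  rw [← Finset.sum_div, Finset.sum_add_distrib, Finset.coe_univ, Finset.sum_const,
    Finset.card_univ, nsmul_eq_mul, mul_one] at key
  have hpos : (0 : ℝ) < Fintype.card V := by exact_mod_cast Fintype.card_pos
  obtain ⟨h1, h2⟩ := abs_lt.1 hlt
  constructor <;> nlinarith
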